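/- For every integer n ≥ 1 and every permutation π ∈ S_n, the fiber of the MVP outcome map over π satisfies |O_n^{-1}(π)| ≤ ∏_{j=1}^{n} |Ω_j(π)|. -/

import Mathlib

open Finset

namespace MVPPark

/-- One step of the MVP parking process: car `c`, preferring spot `p`, arrives at the
state `state` (recording, for each spot, the car parked there, if any).  Car `c` always
parks in spot `p`; if spot `p` was occupied by an (earlier) car `j`, then `j` is bumped
and parks in the first unoccupied spot strictly beyond `p`, if such a spot exists
(otherwise `j` drives off unparked). -/
def mvpStep {n : ℕ} (state : Fin n → Option (Fin n)) (c p : Fin n) :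
    Fin n → Option (Fin n) :=
  match state p with
  | none => Function.update state p (some c)
  | some j =>
    match (List.finRange n).find? (fun k => decide (p < k) && (state k).isNone) with
    | none => Function.update state p (some c)
    | some k => Function.update (Function.update state p (some c)) k (some j)

/-- The final state of the MVP parking process with preference list `α`:
cars `0, 1, …, n-1` enter in order, car `i` preferring spot `α i`. -/
def mvpRun {n : ℕ} (α : Fin n → Fin n) : Fin n → Option (Fin n) :=
  (List.finRange n).foldl (fun st c => mvpStep st c (α c)) (fun _ => none)

/-- `α` is an MVP parking function: under the MVP rule, all `n` cars end up parked. -/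
def IsMVP {n : ℕ} (α : Fin n → Fin n) : Prop :=
  ∀ c : Fin n, ∃ j : Fin n, mvpRun α j = some c

/-- The outcome of the MVP parking process on `α` is the permutation `π`:
for each `j`, spot `j` ends up occupied by car `π j`. -/
def MvpOutcome {n : ℕ} (α : Fin n → Fin n) (π : Equiv.Perm (Fin n)) : Prop :=
  ∀ j : Fin n, mvpRun α j = some (π j)

end MVPPark

namespace MVPPark

/-- `C_j(π)`: the set of cars arriving after car `π j` that park to the left of
spot `j`, together with car `π j` itself. -/
def Cset {n : ℕ} (π : Equiv.Perm (Fin n)) (j : Fin n) : Finset (Fin n) :=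
  ((Finset.univ.filter (fun k => k < j)).image π ∩
      Finset.univ.filter (fun c => π j < c)) ∪ {π j}

/-- `Ω_j(π)`: the set of spots on or to the left of spot `j` occupied (in the outcome
`π`) by a car of `C_j(π)`. -/
def Omega {n : ℕ} (π : Equiv.Perm (Fin n)) (j : Fin n) : Finset (Fin n) :=
  Finset.univ.filter (fun k => k ≤ j ∧ π k ∈ Cset π j)

end MVPPark

namespace MVPPark

/-- A step changes only the preferred spot, unless it also moves the bumped car into an
unoccupied spot beyond it. -/
lemma mvpStep_cases {n : ℕ} (state : Fin n → Option (Fin n)) (c p : Fin n) :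
    mvpStep state c p = Function.update state p (some c) ∨
      ∃ j k, state p = some j ∧ p < k ∧ state k = none ∧
        mvpStep state c p = Function.update (Function.update state p (some c)) k (some j) := by
  rcases hp : state p with - | j
  · exact .inl (by simp [mvpStep, hp])
  · rcases hfind : (List.finRange n).find?
      (fun k => decide (p < k) && (state k).isNone) with - | k
    · exact .inl (by simp only [mvpStep, hp, hfind])
    · obtain ⟨hlt, hnone⟩ : p < k ∧ state k = none := by simpa using List.find?_some hfind
      exact .inr ⟨j, k, rfl, hlt, hnone, by simp only [mvpStep, hp, hfind]⟩

/-- After a step, the arriving car is in its preferred spot, and any other occupied spot holds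
either its previous occupant or a car bumped forward from the preferred spot. -/
lemma mvpStep_eq_some {n : ℕ} {state : Fin n → Option (Fin n)} {c p k d : Fin n}
    (h : mvpStep state c p k = some d) :
    (k = p ∧ d = c) ∨ state k = some d ∨ (p < k ∧ state p = some d) := by
  rcases mvpStep_cases state c p with e | ⟨j, m, hp, hlt, hm, e⟩ <;> rw [e] at h <;>
    grind [Function.update_apply]

lemma mvpStep_self {n : ℕ} (state : Fin n → Option (Fin n)) (c p : Fin n) :
    mvpStep state c p p = some c := by
  rcases mvpStep_cases state c p with e | ⟨j, m, hp, hlt, hm, e⟩ <;> rw [e] <;>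
    grind [Function.update_apply]

/-- An occupied spot other than the one preferred by the arriving car keeps its occupant. -/
lemma mvpStep_of_ne {n : ℕ} {state : Fin n → Option (Fin n)} {c p k d : Fin n}
    (hk : k ≠ p) (h : state k = some d) : mvpStep state c p k = some d := by
  rcases mvpStep_cases state c p with e | ⟨j, m, hp, hlt, hm, e⟩ <;> rw [e] <;>
    grind [Function.update_apply]

/-- When cars arrive in increasing order, every car sits at or beyond its preferred spot, and
the preferred spot of each car that has arrived is occupied by that car or a later one. -/
lemma foldl_mvpStep_invariant {n : ℕ} (α : Fin n → Fin n) (l : List (Fin n))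
    (hl : l.Pairwise (· < ·)) :
    (∀ k c, l.foldl (fun st c => mvpStep st c (α c)) (fun _ => none) k = some c → α c ≤ k) ∧
    ∀ c ∈ l, ∃ d,
      l.foldl (fun st c => mvpStep st c (α c)) (fun _ => none) (α c) = some d ∧ c ≤ d := by
  induction l using List.reverseRecOn with
  | nil => simp
  | append_singleton l x ih =>
    obtain ⟨hl', -, hx⟩ := List.pairwise_append.mp hl
    obtain ⟨hge, hocc⟩ := ih hl'
    simp only [List.foldl_append, List.foldl_cons, List.foldl_nil]
    refine ⟨fun k c h => ?_, fun c hc => ?_⟩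
    · rcases mvpStep_eq_some h with ⟨rfl, rfl⟩ | h | ⟨hlt, h⟩
      · exact le_rfl
      · exact hge _ _ h
      · exact (hge _ _ h).trans hlt.le
    · have hcx : c ∈ l ∨ c = x := by simpa using hc
      by_cases hp : α c = α x
      · refine ⟨x, hp ▸ mvpStep_self _ _ _, ?_⟩
        rcases hcx with hc | rfl
        · exact (hx c hc x (by simp)).le
        · exact le_rfl
      · rcases hcx with hc | rfl
        · obtain ⟨d, hd, hcd⟩ := hocc c hc
          exact ⟨d, mvpStep_of_ne hp hd, hcd⟩
        · exact absurd rfl hp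

/-- The car parked in spot `j` preferred a spot of `Ω_j(π)`. -/
lemma MvpOutcome.mem_Omega {n : ℕ} {α : Fin n → Fin n} {π : Equiv.Perm (Fin n)}
    (h : MvpOutcome α π) (j : Fin n) : α (π j) ∈ Omega π j := by
  obtain ⟨hge, hocc⟩ :=
    foldl_mvpStep_invariant α (List.finRange n) (List.pairwise_lt_finRange n)
  have hle : α (π j) ≤ j := hge _ _ (h j)
  obtain ⟨d, hd, hjd⟩ := hocc (π j) (List.mem_finRange _)
  obtain rfl : π (α (π j)) = d := Option.some.inj ((h _).symm.trans hd)
  rcases hle.eq_or_lt with heq | hlt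
  · simp [Omega, Cset, heq]
  · have hne : π j ≠ π (α (π j)) := fun e => hlt.ne' (π.injective e)
    simp [Omega, Cset, hle, hlt, lt_of_le_of_ne hjd hne]

end MVPPark

open MVPPark in
/-- Upper bound on the fiber of the MVP outcome map:
`|O⁻¹(π)| ≤ ∏_j |Ω_j(π)|`. -/
theorem fiber_le_prod_omega (n : ℕ) (hn : 1 ≤ n) (π : Equiv.Perm (Fin n)) :
    Nat.card {α : Fin n → Fin n // MvpOutcome α π} ≤ ∏ j : Fin n, (Omega π j).card := by
  have hinj : Function.Injective (fun α : {α : Fin n → Fin n // MvpOutcome α π} =>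
      (⟨α.1 ∘ π, Fintype.mem_piFinset.mpr α.2.mem_Omega⟩ : Fintype.piFinset (Omega π))) :=
    fun α β h => Subtype.ext (π.surjective.injective_comp_right (congrArg Subtype.val h))
  exact (Nat.card_le_card_of_injective _ hinj).trans_eq
    (by rw [Nat.card_eq_fintype_card, Fintype.card_coe, Fintype.card_piFinset])
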